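/- arXiv:2511.23472 — 2 statements merged into one kernel-verified Lean document; each statement's English description precedes it below -/
import Mathlib

section
/- Associativity of the sum of SL propositions: for all SL propositions P, Q, R, the propositions (P + Q) + R and P + (Q + R) mutually entail each other (i.e. they are equal as sets of multisets of resources). -/
open scoped Classical

noncomputable section

namespace QSL

/-! ## Resources -/

/-- Vectors over the Hilbert space with orthonormal basis indexed by `Q → {0,1}`. -/
def Vec {Qubit : Type} (Q : Finset Qubit) : Type := ({ q // q ∈ Q } → Bool) → ℂ

/-- A quantum state: a finite set of qubits together with a vector over them. -/
def QState (Qubit : Type) : Type := Σ Q : Finset Qubit, Vec Q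

/-- A store: a partial function from variables to values. -/
def Store (Var Val : Type) : Type := Var → Option Val

/-- A resource: a quantum state together with a store. -/
def Res (Qubit Var Val : Type) : Type := QState Qubit × Store Var Val

variable {Qubit Var Val : Type}

/-- Tensor product of vectors over disjoint qubit sets. -/
def tensorVec {Q Q' : Finset Qubit} (v : Vec Q) (w : Vec Q') : Vec (Q ∪ Q') := fun f =>
  v (fun q => f ⟨q.1, Finset.mem_union_left _ q.2⟩) *
  w (fun q => f ⟨q.1, Finset.mem_union_right _ q.2⟩)

/-- Transport of a vector along an equality of qubit sets. -/
def castVec {Q Q' : Finset Qubit} (h : Q = Q') (v : Vec Q) : Vec Q' := h ▸ v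

/-- The empty quantum state with scalar 1. -/
def unitQ : QState Qubit := ⟨(∅ : Finset Qubit), fun _ => 1⟩

/-- The unit resource: empty qubit set with scalar 1 and the empty store. -/
def unitRes : Res Qubit Var Val := (unitQ, fun _ => none)

/-- Partial product of resources: defined iff the qubit sets are disjoint and
the store domains are disjoint; takes the union of qubit sets, tensor product of
vectors, and union of stores. -/
def rmul (a b : Res Qubit Var Val) : Option (Res Qubit Var Val) :=
  if h : Disjoint a.1.1 b.1.1 ∧ ∀ x, a.2 x = none ∨ b.2 x = none then
    some (⟨a.1.1 ∪ b.1.1, tensorVec a.1.2 b.1.2⟩, fun x => a.2 x <|> b.2 x)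
  else none

/-- Partial sum of resources: defined iff the two resources have the same
qubit set and the same store; adds the vectors. -/
def radd (a b : Res Qubit Var Val) : Option (Res Qubit Var Val) :=
  if h : a.1.1 = b.1.1 ∧ a.2 = b.2 then
    some (⟨b.1.1, fun f => castVec h.1 a.1.2 f + b.1.2 f⟩, b.2)
  else none

/-- Incompatibility of resources: some variable lies in both store domains and
the stores disagree on it. -/
def incompat (a b : Res Qubit Var Val) : Prop :=
  ∃ x u u', a.2 x = some u ∧ b.2 x = some u' ∧ u ≠ u'

/-! ## Multisets (possibly infinite, as families up to bijective reindexing) -/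

/-- An indexed family representing a multiset. -/
structure PreMSet (A : Type) : Type 1 where
  idx : Type
  val : idx → A

/-- Equivalence of indexed families by bijective reindexing. -/
def msetEquiv {A : Type} (f g : PreMSet A) : Prop :=
  ∃ e : f.idx ≃ g.idx, ∀ i, f.val i = g.val (e i)

theorem msetEquiv_refl {A : Type} (f : PreMSet A) : msetEquiv f f :=
  ⟨Equiv.refl _, fun _ => rfl⟩

theorem msetEquiv_symm {A : Type} {f g : PreMSet A} : msetEquiv f g → msetEquiv g f
  | ⟨e, h⟩ => ⟨e.symm, fun i => by rw [h (e.symm i), Equiv.apply_symm_apply]⟩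

theorem msetEquiv_trans {A : Type} {f g k : PreMSet A} :
    msetEquiv f g → msetEquiv g k → msetEquiv f k
  | ⟨e, h⟩, ⟨e', h'⟩ => ⟨e.trans e', fun i => (h i).trans (h' (e i))⟩

instance msetSetoid (A : Type) : Setoid (PreMSet A) :=
  ⟨msetEquiv, ⟨msetEquiv_refl, msetEquiv_symm, msetEquiv_trans⟩⟩

/-- Multisets over `A`: families up to bijective reindexing. -/
def MSet (A : Type) : Type 1 := Quotient (msetSetoid A)

def MSet.mk {A : Type} (I : Type) (f : I → A) : MSet A :=
  Quotient.mk (msetSetoid A) ⟨I, f⟩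

/-- A canonical representative family of a multiset. -/
def MSet.out {A : Type} (m : MSet A) : PreMSet A := Quotient.out m

/-- `a` is an occurrence of the multiset `m`. -/
def MSet.MemM {A : Type} (a : A) (m : MSet A) : Prop := ∃ i, m.out.val i = a

def MSet.map {A B : Type} (f : A → B) (m : MSet A) : MSet B :=
  MSet.mk m.out.idx (fun i => f (m.out.val i))

/-- Sum (disjoint union) of two multisets. -/
def MSet.uplus {A : Type} (m m' : MSet A) : MSet A :=
  MSet.mk (m.out.idx ⊕ m'.out.idx) (Sum.elim m.out.val m'.out.val)

/-- Indexed sum (disjoint union) of a family of multisets. -/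
def MSet.biguplus {A : Type} (I : Type) (f : I → MSet A) : MSet A :=
  MSet.mk (Σ x : I, (f x).out.idx) (fun p => (f p.1).out.val p.2)


/-- Partial product of multisets of resources: an occurrence `a·b` for every
pair of occurrences, defined iff all these resource products are defined. -/
def mprodM (m m' : MSet (Res Qubit Var Val)) : Option (MSet (Res Qubit Var Val)) :=
  if h : ∀ (i : m.out.idx) (j : m'.out.idx), (rmul (m.out.val i) (m'.out.val j)).isSome then
    some (MSet.mk (m.out.idx × m'.out.idx)
      (fun p => (rmul (m.out.val p.1) (m'.out.val p.2)).get (h p.1 p.2)))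
  else none

/-- Sum of the two projections of a multiset of pairs of resources (the
multiset of pairs plays the role of a multiset bijection between its two
projections): defined iff all the componentwise resource sums are defined. -/
def msumr (r : MSet (Res Qubit Var Val × Res Qubit Var Val)) :
    Option (MSet (Res Qubit Var Val)) :=
  if h : ∀ i, (radd (r.out.val i).1 (r.out.val i).2).isSome then
    some (MSet.mk r.out.idx (fun i => (radd (r.out.val i).1 (r.out.val i).2).get (h i)))
  else none

/-! ## SL propositions -/

/-- An SL proposition: a set of multisets of resources. -/
abbrev SLProp (Qubit Var Val : Type) : Type 1 := Set (MSet (Res Qubit Var Val))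


/-- Entailment of SL propositions: set inclusion. -/
def entails (P Q : SLProp Qubit Var Val) : Prop := P ⊆ Q

/-- Separating conjunction. -/
def star (P Q : SLProp Qubit Var Val) : SLProp Qubit Var Val :=
  { m | ∃ mp ∈ P, ∃ mq ∈ Q, mprodM mp mq = some m }

/-- Sum of SL propositions: all defined sums `m +_r m'` over `m ∈ P`, `m' ∈ Q`
and multiset bijections `r` between `m` and `m'`. -/
def propSum (P Q : SLProp Qubit Var Val) : SLProp Qubit Var Val :=
  { m | ∃ r : MSet (Res Qubit Var Val × Res Qubit Var Val),
      MSet.map Prod.fst r ∈ P ∧ MSet.map Prod.snd r ∈ Q ∧ msumr r = some m }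

/-- Indexed bare mixing. -/
def bigMix (I : Type) (P : I → SLProp Qubit Var Val) : SLProp Qubit Var Val :=
  { m | ∃ f : I → MSet (Res Qubit Var Val), (∀ x, f x ∈ P x) ∧ m = MSet.biguplus I f }

/-- Binary bare mixing, the case of `bigMix` over a two-element index set. -/
def binMix (P Q : SLProp Qubit Var Val) : SLProp Qubit Var Val :=
  bigMix Bool (fun b => if b then Q else P)

/-- Precision: any two multisets in `P` are equal. -/
def precise (P : SLProp Qubit Var Val) : Prop := ∀ m ∈ P, ∀ m' ∈ P, m = m'

/-- Non-emptiness of behaviours: every multiset in `P` is nonempty. -/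
def nonnb (P : SLProp Qubit Var Val) : Prop := ∀ m ∈ P, Nonempty (MSet.out m).idx

/-- Unambiguity: any two occurrences at distinct indices are incompatible. -/
def unambig (P : SLProp Qubit Var Val) : Prop :=
  ∀ m ∈ P, ∀ i j : (MSet.out m).idx, i ≠ j → incompat (m.out.val i) (m.out.val j)

/-- Incompatibility of SL propositions: every occurrence of every `m ∈ P` is
incompatible with every occurrence of every `m' ∈ Q`. -/
def propIncompat (P Q : SLProp Qubit Var Val) : Prop :=
  ∀ m ∈ P, ∀ m' ∈ Q, ∀ (i : (MSet.out m).idx) (j : (MSet.out m').idx),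
    incompat (m.out.val i) (m'.out.val j)

/-- The singleton proposition of the one-element multiset of a resource. -/
def singletonProp (a : Res Qubit Var Val) : SLProp Qubit Var Val :=
  { m | m = MSet.mk PUnit (fun _ => a) }

/-- The points-to proposition `ι ↦ v`: empty quantum state (scalar 1) and the
store mapping only `ι` to `v`. -/
def varPoints (ι : Var) (v : Val) : SLProp Qubit Var Val :=
  singletonProp (unitQ, fun y => if y = ι then some v else none)

/-- Tagged mixing over an index set of values. -/
def taggedMix (ι : Var) (I : Set Val) (P : Val → SLProp Qubit Var Val) :
    SLProp Qubit Var Val :=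
  bigMix I (fun x => star (varPoints ι x.1) (P x.1))

theorem mk_eq_iff {A : Type} {I J : Type} {f : I → A} {g : J → A} :
    MSet.mk I f = MSet.mk J g ↔ ∃ e : I ≃ J, ∀ i, f i = g (e i) :=
  ⟨fun h => Quotient.exact h, fun h => Quotient.sound h⟩

theorem mk_out {A : Type} (m : MSet A) : MSet.mk m.out.idx m.out.val = m :=
  Quotient.out_eq m

theorem map_mk {A B : Type} (φ : A → B) (I : Type) (f : I → A) :
    MSet.map φ (MSet.mk I f) = MSet.mk I (fun i => φ (f i)) := by
  obtain ⟨e, he⟩ := mk_eq_iff.1 (mk_out (MSet.mk I f))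
  exact mk_eq_iff.2 ⟨e, fun i => by rw [he]⟩

theorem mem_propSum {Qubit Var Val : Type} (P Q : SLProp Qubit Var Val)
    (m : MSet (Res Qubit Var Val)) :
    m ∈ propSum P Q ↔ ∃ (I : Type) (f g h : I → Res Qubit Var Val),
      MSet.mk I f ∈ P ∧ MSet.mk I g ∈ Q ∧ (∀ i, radd (f i) (g i) = some (h i)) ∧
      m = MSet.mk I h := by
  constructor
  · rintro ⟨r, hP, hQ, hm⟩
    unfold msumr at hm
    split_ifs at hm with h
    refine ⟨r.out.idx, fun i => (r.out.val i).1, fun i => (r.out.val i).2, _, hP, hQ, ?_,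
      (Option.some.inj hm).symm⟩
    intro i
    exact (Option.some_get (h i)).symm
  · rintro ⟨I, f, g, h, hP, hQ, hs, rfl⟩
    refine ⟨MSet.mk I (fun i => (f i, g i)), ?_, ?_, ?_⟩
    · rw [map_mk]; exact hP
    · rw [map_mk]; exact hQ
    · obtain ⟨e, he⟩ := mk_eq_iff.1 (mk_out (MSet.mk I (fun i => (f i, g i))))
      have hv : ∀ i, radd ((MSet.mk I (fun i => (f i, g i))).out.val i).1
          ((MSet.mk I (fun i => (f i, g i))).out.val i).2 = some (h (e i)) := by
        intro i
        rw [he i]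
        exact hs (e i)
      unfold msumr
      rw [dif_pos (fun i => by rw [hv i]; rfl)]
      refine congrArg some (mk_eq_iff.2 ⟨e, fun i => ?_⟩)
      exact Option.get_of_eq_some _ (hv i)

theorem radd_eq {Qubit Var Val : Type} (Q : Finset Qubit) (v w : Vec Q) (s : Store Var Val) :
    radd ((⟨Q, v⟩, s) : Res Qubit Var Val) (⟨Q, w⟩, s) = some (⟨Q, fun f => v f + w f⟩, s) := by
  unfold radd
  rw [dif_pos ⟨rfl, rfl⟩]
  rfl

theorem radd_inv {Qubit Var Val : Type} {a b c : Res Qubit Var Val} (h : radd a b = some c) :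
    ∃ (Q : Finset Qubit) (v w : Vec Q) (s : Store Var Val),
      a = (⟨Q, v⟩, s) ∧ b = (⟨Q, w⟩, s) ∧ c = (⟨Q, fun f => v f + w f⟩, s) := by
  obtain ⟨⟨Q, v⟩, s⟩ := a
  obtain ⟨⟨Q', w⟩, s'⟩ := b
  have hh : Q = Q' ∧ s = s' := by
    unfold radd at h
    split_ifs at h with h'
    exact h'
  obtain ⟨rfl, rfl⟩ := hh
  rw [radd_eq] at h
  exact ⟨Q, v, w, s, rfl, rfl, (Option.some.inj h).symm⟩

theorem radd_assoc1 {Qubit Var Val : Type} {a b c d e : Res Qubit Var Val}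
    (h : radd a b = some c) (h' : radd c d = some e) :
    ∃ x, radd b d = some x ∧ radd a x = some e := by
  obtain ⟨Q, v, w, s, rfl, rfl, rfl⟩ := radd_inv h
  obtain ⟨Q', v', w', s', h1, rfl, rfl⟩ := radd_inv h'
  cases h1
  refine ⟨_, radd_eq _ _ _ _, ?_⟩
  have hv : (fun f => v f + (w f + w' f) : Vec Q) = (fun f => (v f + w f) + w' f : Vec Q) :=
    funext fun f => (add_assoc (v f : ℂ) (w f) (w' f)).symm
  exact (radd_eq Q _ _ s).trans
    (congrArg (fun u : Vec Q => some ((⟨Q, u⟩, s) : Res Qubit Var Val)) hv)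

theorem radd_assoc2 {Qubit Var Val : Type} {a b c d e : Res Qubit Var Val}
    (h : radd b d = some c) (h' : radd a c = some e) :
    ∃ x, radd a b = some x ∧ radd x d = some e := by
  obtain ⟨Q, v, w, s, rfl, rfl, rfl⟩ := radd_inv h
  obtain ⟨Q', v', w', s', rfl, h1, rfl⟩ := radd_inv h'
  cases h1
  refine ⟨_, radd_eq _ _ _ _, ?_⟩
  have hv : (fun f => (v' f + v f) + w f : Vec Q) = (fun f => v' f + (v f + w f) : Vec Q) :=
    funext fun f => add_assoc (v' f : ℂ) (v f) (w f)
  exact (radd_eq Q _ _ s).trans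
    (congrArg (fun u : Vec Q => some ((⟨Q, u⟩, s) : Res Qubit Var Val)) hv)

theorem mk_reindex {A : Type} {I J : Type} (e : I ≃ J) (f : J → A) :
    MSet.mk I (fun i => f (e i)) = MSet.mk J f :=
  mk_eq_iff.2 ⟨e, fun _ => rfl⟩

/-- Associativity of the sum of SL propositions. -/
theorem propSum_assoc {Qubit Var Val : Type} (P Q R : SLProp Qubit Var Val) :
    propSum (propSum P Q) R = propSum P (propSum Q R) := by
  ext m
  constructor
  · intro hm
    obtain ⟨I, f, g, h, hf, hg, hs, rfl⟩ := (mem_propSum _ _ _).1 hm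
    obtain ⟨J, f', g', h', hf', hg', hs', he⟩ := (mem_propSum _ _ _).1 hf
    obtain ⟨e, he⟩ := mk_eq_iff.1 he
    have key : ∀ i, ∃ x, radd (g' (e i)) (g i) = some x ∧ radd (f' (e i)) x = some (h i) :=
      fun i => radd_assoc1 ((hs' (e i)).trans (congrArg some (he i).symm)) (hs i)
    choose x hx hx' using key
    refine (mem_propSum _ _ _).2 ⟨I, fun i => f' (e i), x, h, ?_, ?_, hx', rfl⟩
    · rw [mk_reindex]; exact hf'
    · refine (mem_propSum _ _ _).2 ⟨I, fun i => g' (e i), g, x, ?_, hg, hx, rfl⟩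
      rw [mk_reindex]; exact hg'
  · intro hm
    obtain ⟨I, f, g, h, hf, hg, hs, rfl⟩ := (mem_propSum _ _ _).1 hm
    obtain ⟨J, f', g', h', hf', hg', hs', he⟩ := (mem_propSum _ _ _).1 hg
    obtain ⟨e, he⟩ := mk_eq_iff.1 he
    have key : ∀ i, ∃ x, radd (f i) (f' (e i)) = some x ∧ radd x (g' (e i)) = some (h i) :=
      fun i => radd_assoc2 ((hs' (e i)).trans (congrArg some (he i).symm)) (hs i)
    choose x hx hx' using key
    refine (mem_propSum _ _ _).2 ⟨I, x, fun i => g' (e i), h, ?_, ?_, hx', rfl⟩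
    · refine (mem_propSum _ _ _).2 ⟨I, f, fun i => f' (e i), x, hf, ?_, hx, rfl⟩
      rw [mk_reindex]; exact hf'
    · rw [mk_reindex]; exact hg'
end QSL
end
end

section
/- Precision of sums (sum-precise): if SL propositions P and Q are both precise and P is unambiguous, then P + Q is precise. -/
open scoped Classical

noncomputable section

namespace QSL

variable {Qubit Var Val : Type}

theorem unambig_aux (P : SLProp Qubit Var Val) (hu : unambig P) (I : Type)
    (f : I → Res Qubit Var Val) (hm : MSet.mk I f ∈ P) (i j : I) (hs : (f i).2 = (f j).2) :
    i = j := by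
  by_contra hne
  have hout : Quotient.mk (msetSetoid _) (MSet.out (MSet.mk I f)) =
      Quotient.mk (msetSetoid _) ⟨I, f⟩ := Quotient.out_eq _
  obtain ⟨e, he⟩ : msetEquiv _ _ := Quotient.exact hout
  obtain ⟨x, u, u', h1, h2, h3⟩ := hu _ hm (e.symm i) (e.symm j)
    (fun h => hne (e.symm.injective h))
  rw [he, Equiv.apply_symm_apply] at h1 h2
  change (f i).2 x = some u at h1
  change (f j).2 x = some u' at h2
  rw [hs, h2] at h1
  exact h3 (Option.some.inj h1).symm

theorem radd_store (a b : Res Qubit Var Val) (h : (radd a b).isSome) : a.2 = b.2 := by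
  unfold radd at h
  split_ifs at h with h'
  · exact h'.2
  · simp at h

/-- Precision of sums: if `P` and `Q` are precise and `P` is unambiguous, then
`P + Q` is precise. -/
theorem sum_precise {Qubit Var Val : Type} (P Q : SLProp Qubit Var Val)
    (hP : precise P) (hQ : precise Q) (hu : unambig P) :
    precise (propSum P Q) := by
  rintro m ⟨r, hr1, hr2, hr⟩ m' ⟨r', hr1', hr2', hr'⟩
  obtain ⟨e, he⟩ : msetEquiv _ _ := Quotient.exact (hP _ hr1 _ hr1')
  obtain ⟨d, hd⟩ : msetEquiv _ _ := Quotient.exact (hQ _ hr2 _ hr2')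
  unfold msumr at hr hr'
  split_ifs at hr with h
  split_ifs at hr' with h'
  rw [← Option.some.inj hr, ← Option.some.inj hr']
  change ∀ i : r.out.idx, (r.out.val i).1 = (r'.out.val (e i)).1 at he
  change ∀ i : r.out.idx, (r.out.val i).2 = (r'.out.val (d i)).2 at hd
  have hed : ∀ i : r.out.idx, e i = d i := by
    intro i
    refine unambig_aux P hu _ _ hr1' (e i) (d i) ?_
    change (r'.out.val (e i)).1.2 = (r'.out.val (d i)).1.2
    rw [← he i, radd_store _ _ (h i), hd i, radd_store _ _ (h' (d i))]
  refine Quotient.sound (s := msetSetoid _) ⟨e, fun i => ?_⟩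
  have hv : r.out.val i = r'.out.val (e i) :=
    Prod.ext (he i) ((hd i).trans (by rw [← hed i]))
  change (radd (r.out.val i).1 (r.out.val i).2).get (h i) =
    (radd (r'.out.val (e i)).1 (r'.out.val (e i)).2).get (h' (e i))
  simp only [hv]
end QSL
end
end
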